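/- arXiv:2006.10945 — 6 statements merged into one kernel-verified Lean document; each statement's English description precedes it below -/
import Mathlib

section
/- Let S ⊆ ℝ^m be a nonempty compact convex set, let f : ℝ^m → ℝ be concave and differentiable, and let C ≥ 0 be a constant such that for all x, s ∈ S and all γ ∈ [0,1], f(x + γ(s − x)) ≥ f(x) + γ⟨∇f(x), s − x⟩ − (γ²/2)·C (a curvature bound). Fix η ≥ 0, let x₀ ∈ S, and for each t ≥ 0 set γ_t = 2/(t+2), let h_t ∈ S satisfy ⟨∇f(x_t), h_t⟩ ≥ ⟨∇f(x_t), s⟩ − (η γ_t C)/2 for every s ∈ S, and set x_{t+1} = (1 − γ_t)x_t + γ_t h_t. Then for every maximizer x⋆ of f over S and every t ≥ 1, f(x⋆) − f(x_t) ≤ 2C(1+η)/(t+2). -/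
/-- A concave function lies below its tangent hyperplane at a point of differentiability. -/
lemma ConcaveOn.le_add_fderiv {E : Type*} [NormedAddCommGroup E] [NormedSpace ℝ E] {f : E → ℝ}
    {f' : E →L[ℝ] ℝ} {x : E} (hf : ConcaveOn ℝ Set.univ f) (hx : HasFDerivAt f f' x) (y : E) :
    f y ≤ f x + f' (y - x) := by
  have hconc : ConcaveOn ℝ Set.univ (f ∘ AffineMap.lineMap (k := ℝ) x y) :=
    hf.comp_affineMap (AffineMap.lineMap x y)
  have hderiv : HasDerivAt (f ∘ AffineMap.lineMap (k := ℝ) x y) (f' (y - x)) 0 := by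
    refine HasFDerivAt.comp_hasDerivAt (0 : ℝ) ?_ AffineMap.hasDerivAt_lineMap
    simpa using hx
  have hslope := hconc.slope_le_of_hasDerivAt (Set.mem_univ 0) (Set.mem_univ 1) one_pos hderiv
  simp [slope_def_field] at hslope
  rw [map_sub]
  linarith

/-- A sequence with `d (t + 1) ≤ (1 - γ) d t + γ² K / 2` for the step sizes `γ = 2 / (t + 2)`
decays like `2 K / (t + 2)`. -/
lemma le_div_of_frankWolfe_recurrence {K : ℝ} (hK : 0 ≤ K) {d : ℕ → ℝ}
    (hd : ∀ t : ℕ, d (t + 1) ≤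
      (1 - 2 / ((t : ℝ) + 2)) * d t + (2 / ((t : ℝ) + 2)) ^ 2 / 2 * K)
    (t : ℕ) (ht : 1 ≤ t) : d t ≤ 2 * K / ((t : ℝ) + 2) := by
  induction t, ht using Nat.le_induction with
  | base =>
    have h0 := hd 0
    norm_num at h0 ⊢
    linarith
  | succ t ht ih =>
    have hγ : 0 ≤ 1 - 2 / ((t : ℝ) + 2) := by
      rw [sub_nonneg, div_le_one (by positivity)]
      linarith [t.cast_nonneg (α := ℝ)]
    calc d (t + 1)
        ≤ (1 - 2 / ((t : ℝ) + 2)) * (2 * K / ((t : ℝ) + 2))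
          + (2 / ((t : ℝ) + 2)) ^ 2 / 2 * K := by
          linarith [hd t, mul_le_mul_of_nonneg_left ih hγ]
      _ = 2 * K * ((t : ℝ) + 1) / ((t : ℝ) + 2) ^ 2 := by field_simp; ring
      _ ≤ 2 * K / (((t + 1 : ℕ) : ℝ) + 2) := by
          push_cast
          rw [div_le_div_iff₀ (by positivity) (by positivity)]
          nlinarith

/-- **Frank–Wolfe convergence with approximate linear subproblems.**
Let `S ⊆ ℝ^m` be a nonempty compact convex set, `f` concave and differentiable, and `C ≥ 0`
a curvature bound for `f` on `S`.  Run Frank–Wolfe with step sizes `γ_t = 2/(t+2)` where the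
linear maximization subproblem is solved with additive error at most `η γ_t C / 2`.
Then for any maximizer `x⋆` of `f` over `S` and any `t ≥ 1`,
`f x⋆ - f (x t) ≤ 2 C (1+η) / (t+2)`.  Here `⟨∇f(x), v⟩` is rendered as `fderiv ℝ f x v`. -/
theorem frankWolfe_approx_convergence {m : ℕ}
    (S : Set (EuclideanSpace ℝ (Fin m))) (hS_ne : S.Nonempty) (hS_cpt : IsCompact S)
    (hS_conv : Convex ℝ S)
    (f : EuclideanSpace ℝ (Fin m) → ℝ)
    (hf_conc : ConcaveOn ℝ Set.univ f) (hf_diff : Differentiable ℝ f)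
    (C : ℝ) (hC : 0 ≤ C)
    (hcurv : ∀ x ∈ S, ∀ s ∈ S, ∀ γ ∈ Set.Icc (0:ℝ) 1,
      f (x + γ • (s - x)) ≥ f x + γ * (fderiv ℝ f x (s - x)) - γ ^ 2 / 2 * C)
    (η : ℝ) (hη : 0 ≤ η)
    (x h : ℕ → EuclideanSpace ℝ (Fin m))
    (hx0 : x 0 ∈ S) (hh : ∀ t, h t ∈ S)
    (hh_approx : ∀ t : ℕ, ∀ s ∈ S,
      fderiv ℝ f (x t) (h t) ≥ fderiv ℝ f (x t) s - η * (2 / ((t : ℝ) + 2)) * C / 2)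
    (hupd : ∀ t : ℕ, x (t + 1) = (1 - 2 / ((t : ℝ) + 2)) • x t + (2 / ((t : ℝ) + 2)) • h t)
    (xstar : EuclideanSpace ℝ (Fin m)) (hxstar : xstar ∈ S)
    (hmax : ∀ y ∈ S, f y ≤ f xstar) :
    ∀ t : ℕ, 1 ≤ t → f xstar - f (x t) ≤ 2 * C * (1 + η) / ((t : ℝ) + 2) := by
  have hγ (t : ℕ) : 2 / ((t : ℝ) + 2) ∈ Set.Icc (0 : ℝ) 1 :=
    ⟨by positivity, (div_le_one (by positivity)).2 (by linarith [t.cast_nonneg (α := ℝ)])⟩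
  have hstep (t : ℕ) : x (t + 1) = x t + (2 / ((t : ℝ) + 2)) • (h t - x t) := by
    rw [hupd]
    module
  have hxS (t : ℕ) : x t ∈ S := by
    induction t with
    | zero => exact hx0
    | succ t ih =>
      rw [hstep]
      exact hS_conv.add_smul_sub_mem ih (hh t) (hγ t)
  have hrec (t : ℕ) : f xstar - f (x (t + 1)) ≤
      (1 - 2 / ((t : ℝ) + 2)) * (f xstar - f (x t))
        + (2 / ((t : ℝ) + 2)) ^ 2 / 2 * (C * (1 + η)) := by
    have hdescent := hcurv (x t) (hxS t) (h t) (hh t) _ (hγ t)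
    have htangent := hf_conc.le_add_fderiv (hf_diff (x t)).hasFDerivAt xstar
    have happrox := hh_approx t xstar hxstar
    have hγ0 := (hγ t).1
    rw [← hstep] at hdescent
    rw [map_sub] at hdescent htangent
    generalize 2 / ((t : ℝ) + 2) = γ at *
    have hgap : f xstar - f (x t) - η * γ * C / 2 ≤
        fderiv ℝ f (x t) (h t) - fderiv ℝ f (x t) (x t) := by linarith
    linarith [mul_le_mul_of_nonneg_left hgap hγ0]
  intro t ht
  rw [mul_assoc]
  exact le_div_of_frankWolfe_recurrence (K := C * (1 + η)) (d := fun t => f xstar - f (x t))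
    (by positivity) hrec t ht
end

section
/- Let C, A_1, …, A_d be symmetric n×n real matrices with each A_i positive semidefinite and λ_max(A_i) ≤ ω, let b ∈ ℝ^d, and let α, β, M > 0. Define A(X) = (⟨A_1,X⟩, …, ⟨A_d,X⟩) ∈ ℝ^d and g(X) = ⟨C,X⟩ − β·φ_M(A(X) − b), and let S = {X ∈ 𝕊^n : X ⪰ 0, Tr(X) ≤ α}. Then for all X, H ∈ S and all γ ∈ [0,1], g((1−γ)X + γH) ≥ g(X) + γ·Dg(X)[H − X] − γ²·β·M·ω²·α², where Dg(X)[·] denotes the derivative of g at X applied to the direction H − X. -/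
/-- The LogSumExp penalty `φ_M(v) = (1/M)·log (∑ i, e^{M v_i} + ∑ i, e^{-M v_i})`. -/
noncomputable def logSumExpPenalty (d : ℕ) (M : ℝ) (v : Fin d → ℝ) : ℝ :=
  (1 / M) * Real.log (∑ i, Real.exp (M * v i) + ∑ i, Real.exp (-(M * v i)))

/-- The trace inner product `⟨A, B⟩ = Tr(Aᵀ B)` on `n × n` real matrices. -/
noncomputable def traceInner {n : ℕ} (A B : Matrix (Fin n) (Fin n) ℝ) : ℝ :=
  (A.transpose * B).trace

attribute [local instance] Matrix.normedAddCommGroup Matrix.normedSpace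

/-- Hoeffding's lemma in LogSumExp form: first-order expansion of `log ∑ exp` with
quadratic remainder. -/
lemma log_sum_exp_add_le {ι : Type*} [Fintype ι] [Nonempty ι] (u s : ι → ℝ) (T : ℝ)
    (hs : ∀ i, |s i| ≤ T) :
    Real.log (∑ i, Real.exp (u i + s i)) ≤ Real.log (∑ i, Real.exp (u i)) +
      (∑ i, Real.exp (u i) * s i) / (∑ i, Real.exp (u i)) + T ^ 2 / 2 := by
  classical
  let _ : MeasurableSpace ι := ⊤
  set Z := ∑ i, Real.exp (u i)
  have hZ : 0 < Z := Finset.sum_pos (fun i _ => Real.exp_pos _) Finset.univ_nonempty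
  have hp : ∀ i, 0 ≤ Real.exp (u i) / Z := fun i => by positivity
  have hsum : ∑ i, ENNReal.ofReal (Real.exp (u i) / Z) = 1 := by
    rw [← ENNReal.ofReal_sum_of_nonneg fun i _ => hp i, ← Finset.sum_div, div_self hZ.ne',
      ENNReal.ofReal_one]
  let p : PMF ι := PMF.ofFintype _ hsum
  have integral_p (f : ι → ℝ) :
      ∫ i, f i ∂p.toMeasure = (∑ i, Real.exp (u i) * f i) / Z := by
    rw [PMF.integral_eq_sum, Finset.sum_div]
    refine Finset.sum_congr rfl fun i _ => ?_
    simp only [p, PMF.ofFintype_apply, ENNReal.toReal_ofReal (hp i), smul_eq_mul]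
    ring
  have hsub := (ProbabilityTheory.hasSubgaussianMGF_of_mem_Icc (μ := p.toMeasure) (X := s)
    (a := -T) (b := T) (measurable_of_finite s).aemeasurable
    (Filter.Eventually.of_forall fun i => abs_le.mp (hs i))).mgf_le 1
  simp only [ProbabilityTheory.mgf, integral_p] at hsub
  set m := (∑ i, Real.exp (u i) * s i) / Z
  have hc : (((‖T - -T‖₊ / 2) ^ 2 : NNReal) : ℝ) * 1 ^ 2 / 2 = T ^ 2 / 2 := by
    push_cast
    rw [Real.norm_eq_abs, div_pow, sq_abs]
    ring
  have hl : ∑ i, Real.exp (u i) * Real.exp (1 * (s i - m)) =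
      Real.exp (-m) * ∑ i, Real.exp (u i + s i) := by
    rw [Finset.mul_sum]
    refine Finset.sum_congr rfl fun i _ => ?_
    rw [← Real.exp_add, ← Real.exp_add]
    ring_nf
  rw [hc, hl, div_le_iff₀ hZ] at hsub
  have hW : 0 < ∑ i, Real.exp (u i + s i) :=
    Finset.sum_pos (fun i _ => Real.exp_pos _) Finset.univ_nonempty
  have := Real.log_le_log (by positivity) hsub
  rw [Real.log_mul (Real.exp_pos _).ne' hW.ne', Real.log_mul (Real.exp_pos _).ne' hZ.ne',
    Real.log_exp, Real.log_exp] at this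
  linarith

/-- The derivative at `0` of the LogSumExp penalty along the line `t ↦ v + t w`. -/
noncomputable def logSumExpPenaltyLineDeriv (d : ℕ) (M : ℝ) (v w : Fin d → ℝ) : ℝ :=
  (∑ i, Real.exp (M * v i) * w i - ∑ i, Real.exp (-(M * v i)) * w i) /
    (∑ i, Real.exp (M * v i) + ∑ i, Real.exp (-(M * v i)))

lemma logSumExpPenalty_add_smul_le {d : ℕ} {M : ℝ} (hM : 0 < M) (v w : Fin d → ℝ) (γ W : ℝ)
    (hw : ∀ i, |w i| ≤ W) :
    logSumExpPenalty d M (fun i => v i + γ * w i) ≤ logSumExpPenalty d M v +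
      γ * logSumExpPenaltyLineDeriv d M v w + γ ^ 2 * M * W ^ 2 / 2 := by
  rcases d.eq_zero_or_pos with rfl | hd
  · simp only [logSumExpPenalty, logSumExpPenaltyLineDeriv, Finset.univ_eq_empty,
      Finset.sum_empty, add_zero, Real.log_zero, mul_zero, sub_zero, div_zero, zero_add]
    positivity
  have : Nonempty (Fin d) := ⟨⟨0, hd⟩⟩
  have h := log_sum_exp_add_le (ι := Fin d ⊕ Fin d)
    (Sum.elim (fun i => M * v i) fun i => -(M * v i))
    (Sum.elim (fun i => M * γ * w i) fun i => -(M * γ * w i)) (M * |γ| * W) (by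
      have (i : Fin d) : |M * γ * w i| ≤ M * |γ| * W := by
        rw [abs_mul, abs_mul, abs_of_pos hM]
        gcongr
        exact hw i
      rintro (i | i)
      · exact this i
      · simpa using this i)
  simp only [Fintype.sum_sum_type, Sum.elim_inl, Sum.elim_inr] at h
  have e1 (i : Fin d) : M * (v i + γ * w i) = M * v i + M * γ * w i := by ring
  have e3 : ∑ i, Real.exp (M * v i) * (M * γ * w i) +
      ∑ i, Real.exp (-(M * v i)) * -(M * γ * w i) =
      M * γ * (∑ i, Real.exp (M * v i) * w i - ∑ i, Real.exp (-(M * v i)) * w i) := by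
    rw [mul_sub, Finset.mul_sum, Finset.mul_sum, sub_eq_add_neg, ← Finset.sum_neg_distrib]
    congr 1 <;> exact Finset.sum_congr rfl fun i _ => by ring
  simp only [logSumExpPenalty, logSumExpPenaltyLineDeriv, e1, neg_add]
  rw [e3, mul_div_assoc] at h
  have h' := mul_le_mul_of_nonneg_left h (by positivity : 0 ≤ 1 / M)
  refine h'.trans (le_of_eq ?_)
  rw [mul_pow, mul_pow, sq_abs]
  field_simp

lemma hasDerivAt_logSumExpPenalty_line {d : ℕ} {M : ℝ} (hM : 0 < M) (v w : Fin d → ℝ) :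
    HasDerivAt (fun t : ℝ => logSumExpPenalty d M (fun i => v i + t * w i))
      (logSumExpPenaltyLineDeriv d M v w) 0 := by
  rcases d.eq_zero_or_pos with rfl | hd
  · simpa [logSumExpPenalty, logSumExpPenaltyLineDeriv] using hasDerivAt_const (0 : ℝ) (0 : ℝ)
  have : Nonempty (Fin d) := ⟨⟨0, hd⟩⟩
  have hl (i : Fin d) : HasDerivAt (fun t : ℝ => M * (v i + t * w i)) (M * w i) 0 := by
    simpa using (((hasDerivAt_id (0 : ℝ)).mul_const (w i)).const_add (v i)).const_mul M
  have h1 := HasDerivAt.fun_sum (u := Finset.univ) fun i _ => (hl i).exp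
  have h2 := HasDerivAt.fun_sum (u := Finset.univ) fun i _ => (hl i).fun_neg.exp
  have hpos : 0 < ∑ i, Real.exp (M * v i) + ∑ i, Real.exp (-(M * v i)) := by positivity
  have h := ((h1.fun_add h2).log (by simpa using hpos.ne')).const_mul (1 / M)
  simp only [zero_mul, add_zero] at h
  refine h.congr_deriv ?_
  have e : ∑ i, Real.exp (M * v i) * (M * w i) + ∑ i, Real.exp (-(M * v i)) * -(M * w i) =
      M * (∑ i, Real.exp (M * v i) * w i - ∑ i, Real.exp (-(M * v i)) * w i) := by
    rw [mul_sub, Finset.mul_sum, Finset.mul_sum, sub_eq_add_neg, ← Finset.sum_neg_distrib]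
    congr 1 <;> exact Finset.sum_congr rfl fun i _ => by ring
  rw [e, logSumExpPenaltyLineDeriv]
  field_simp

lemma differentiable_logSumExpPenalty (d : ℕ) (M : ℝ) :
    Differentiable ℝ (logSumExpPenalty d M) := by
  rcases d.eq_zero_or_pos with rfl | hd
  · exact differentiable_of_subsingleton
  have : Nonempty (Fin d) := ⟨⟨0, hd⟩⟩
  unfold logSumExpPenalty
  have hpos (v : Fin d → ℝ) :
      ∑ i, Real.exp (M * v i) + ∑ i, Real.exp (-(M * v i)) ≠ 0 := by positivity
  fun_prop (disch := exact hpos _)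

lemma traceInner_add_smul {n : ℕ} (A X D : Matrix (Fin n) (Fin n) ℝ) (t : ℝ) :
    traceInner A (X + t • D) = traceInner A X + t * traceInner A D := by
  simp [traceInner, Matrix.mul_add]

lemma traceInner_sub_right {n : ℕ} (A X D : Matrix (Fin n) (Fin n) ℝ) :
    traceInner A (X - D) = traceInner A X - traceInner A D := by
  simp [traceInner, Matrix.mul_sub]

lemma differentiable_traceInner {n : ℕ} (A : Matrix (Fin n) (Fin n) ℝ) :
    Differentiable ℝ (traceInner A) :=
  (LinearMap.toContinuousLinearMap
    (Matrix.traceLinearMap (Fin n) ℝ ℝ ∘ₗ LinearMap.mulLeft ℝ A.transpose)).differentiable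

open scoped MatrixOrder in
lemma traceInner_nonneg {n : ℕ} {A X : Matrix (Fin n) (Fin n) ℝ} (hA : A.PosSemidef)
    (hX : X.PosSemidef) : 0 ≤ traceInner A X := by
  obtain ⟨B, rfl⟩ := CStarAlgebra.nonneg_iff_eq_star_mul_self.mp hA.nonneg
  rw [Matrix.star_eq_conjTranspose]
  have h := (hX.mul_mul_conjTranspose_same B).trace_nonneg
  rw [Matrix.trace_mul_comm, ← Matrix.mul_assoc] at h
  simpa [traceInner, Matrix.conjTranspose_eq_transpose_of_trivial] using h

lemma posSemidef_smul_one_sub {n : ℕ} {A : Matrix (Fin n) (Fin n) ℝ} (hA : A.IsHermitian)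
    {ω : ℝ} (hω : ∀ μ ∈ spectrum ℝ A, μ ≤ ω) :
    (ω • (1 : Matrix (Fin n) (Fin n) ℝ) - A).PosSemidef := by
  have hH : (ω • (1 : Matrix (Fin n) (Fin n) ℝ) - A).IsHermitian := by
    refine Matrix.IsHermitian.sub ?_ hA
    simp [Matrix.IsHermitian]
  refine Matrix.posSemidef_iff_isHermitian_and_spectrum_nonneg.mpr ⟨hH, fun x h => ?_⟩
  rw [← Algebra.algebraMap_eq_smul_one, ← spectrum.singleton_sub_eq] at h
  obtain ⟨_, rfl, μ, hμ, rfl⟩ := Set.mem_sub.mp h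
  exact sub_nonneg.mpr (hω μ hμ)

lemma traceInner_le_mul_trace {n : ℕ} {A X : Matrix (Fin n) (Fin n) ℝ} (hA : A.PosSemidef)
    {ω : ℝ} (hω : ∀ μ ∈ spectrum ℝ A, μ ≤ ω) (hX : X.PosSemidef) :
    traceInner A X ≤ ω * X.trace := by
  have h := traceInner_nonneg (posSemidef_smul_one_sub hA.isHermitian hω) hX
  simpa [traceInner, Matrix.sub_mul] using h

lemma abs_traceInner_sub_le {n : ℕ} {A X H : Matrix (Fin n) (Fin n) ℝ} (hA : A.PosSemidef)
    {ω α : ℝ} (hω : ∀ μ ∈ spectrum ℝ A, μ ≤ ω) (hX : X.PosSemidef) (hXα : X.trace ≤ α)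
    (hH : H.PosSemidef) (hHα : H.trace ≤ α) :
    |traceInner A (H - X)| ≤ |ω| * α := by
  have bound {Y : Matrix (Fin n) (Fin n) ℝ} (hY : Y.PosSemidef) (hYα : Y.trace ≤ α) :
      traceInner A Y ≤ |ω| * α :=
    (traceInner_le_mul_trace hA hω hY).trans <|
      mul_le_mul (le_abs_self ω) hYα hY.trace_nonneg (abs_nonneg ω)
  rw [traceInner_sub_right, abs_le]
  constructor <;>
    linarith [traceInner_nonneg hA hX, traceInner_nonneg hA hH, bound hX hXα, bound hH hHα]

/-- **Curvature bound for the penalized objective of a trace-constrained SDP.**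
Let `C, A₁, …, A_d` be symmetric `n × n` matrices with each `A_i` positive semidefinite and
`λ_max(A_i) ≤ ω`, let `b ∈ ℝ^d` and `α, β, M > 0`.  With
`g(X) = ⟨C, X⟩ - β φ_M(𝒜(X) - b)` where `𝒜(X)_i = ⟨A_i, X⟩`, and
`S = {X ⪰ 0 : Tr X ≤ α}`, for all `X, H ∈ S` and `γ ∈ [0,1]`,
`g((1-γ)X + γH) ≥ g(X) + γ · Dg(X)[H - X] - γ² β M ω² α²`, where `Dg(X)` is the
(Fréchet) derivative of `g` at `X`. -/
theorem penalized_sdp_curvature_bound {n d : ℕ}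
    (C : Matrix (Fin n) (Fin n) ℝ) (A : Fin d → Matrix (Fin n) (Fin n) ℝ)
    (hC : C.IsSymm) (hA : ∀ i, (A i).PosSemidef)
    (ω : ℝ) (hω : ∀ i, ∀ μ ∈ spectrum ℝ (A i), μ ≤ ω)
    (b : Fin d → ℝ) (α β M : ℝ) (hα : 0 < α) (hβ : 0 < β) (hM : 0 < M)
    (g : Matrix (Fin n) (Fin n) ℝ → ℝ)
    (hg : ∀ X, g X = traceInner C X -
      β * logSumExpPenalty d M (fun i => traceInner (A i) X - b i))
    (S : Set (Matrix (Fin n) (Fin n) ℝ))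
    (hSdef : S = {X | X.PosSemidef ∧ X.trace ≤ α}) :
    ∀ X ∈ S, ∀ H ∈ S, ∀ γ ∈ Set.Icc (0:ℝ) 1,
      g ((1 - γ) • X + γ • H) ≥
        g X + γ * (fderiv ℝ g X (H - X)) - γ ^ 2 * β * M * ω ^ 2 * α ^ 2 := by
  subst hSdef
  rintro X ⟨hX, hXα⟩ H ⟨hH, hHα⟩ γ -
  set D := H - X with hD
  set v : Fin d → ℝ := fun i => traceInner (A i) X - b i with hv
  set w : Fin d → ℝ := fun i => traceInner (A i) D with hw
  have hline (t : ℝ) : g (X + t • D) = traceInner C X + t * traceInner C D -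
      β * logSumExpPenalty d M (fun i => v i + t * w i) := by
    rw [hg, traceInner_add_smul]
    simp only [traceInner_add_smul, hv, hw, sub_add_eq_add_sub]
  have hdiff : Differentiable ℝ g := by
    rw [funext hg]
    refine (differentiable_traceInner C).sub (Differentiable.const_mul ?_ β)
    exact (differentiable_logSumExpPenalty d M).comp
      (differentiable_pi.mpr fun i => (differentiable_traceInner (A i)).sub_const (b i))
  have hderiv : fderiv ℝ g X D =
      traceInner C D - β * logSumExpPenaltyLineDeriv d M v w := by
    refine (hdiff X).lineDeriv_eq_fderiv.symm.trans (HasLineDerivAt.lineDeriv ?_)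
    rw [HasLineDerivAt, funext hline]
    have h := (((hasDerivAt_id (0 : ℝ)).mul_const (traceInner C D)).const_add
      (traceInner C X)).sub ((hasDerivAt_logSumExpPenalty_line hM v w).const_mul β)
    rw [one_mul] at h
    exact h
  have hpen := mul_le_mul_of_nonneg_left
    (logSumExpPenalty_add_smul_le hM v w γ (|ω| * α) fun i =>
      abs_traceInner_sub_le (hA i) (hω i) hX hXα hH hHα) hβ.le
  have hpt : (1 - γ) • X + γ • H = X + γ • D := by
    rw [hD, smul_sub, sub_smul, one_smul]
    abel
  rw [hpt, hline, hderiv, hg X]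
  rw [mul_pow, sq_abs] at hpen
  have hrem : 0 ≤ γ ^ 2 * β * M * ω ^ 2 * α ^ 2 := by positivity
  linarith
end

section
/- Let C, A_1, …, A_d be symmetric n×n real matrices, b ∈ ℝ^d, α > 0, and define A(X) = (⟨A_1,X⟩, …, ⟨A_d,X⟩). Suppose X⋆ ⪰ 0 satisfies A(X⋆) = b and Tr(X⋆) ≤ α, and y⋆ ∈ ℝ^d satisfies the Lagrangian optimality condition: ⟨C,X⟩ − ⟨y⋆, A(X) − b⟩ ≤ ⟨C,X⋆⟩ for every positive semidefinite X. Let M > 0, ε ≥ 0, β > ‖y⋆‖₁, and suppose X̂ ⪰ 0 with Tr(X̂) ≤ α is ε-optimal for the penalized problem, i.e., ⟨C,X̂⟩ − β·φ_M(A(X̂) − b) ≥ ⟨C,X⟩ − β·φ_M(A(X) − b) − ε for every X ⪰ 0 with Tr(X) ≤ α. Then: (i) ⟨C,X̂⟩ ≥ ⟨C,X⋆⟩ − ε; (ii) ‖A(X̂) − b‖_∞ ≤ (β·log(2d)/M + ε)/(β − ‖y⋆‖₁); and (iii) ⟨C,X̂⟩ ≤ ⟨C,X⋆⟩ + ‖y⋆‖₁·(β·log(2d)/M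 + ε)/(β − ‖y⋆‖₁). -/
theorem logSumExpPenalty_zero (d : ℕ) (M : ℝ) :
    logSumExpPenalty d M (fun _ => 0) = Real.log (2 * d) / M := by
  simp only [logSumExpPenalty, mul_zero, neg_zero, Real.exp_zero, Finset.sum_const,
    Finset.card_univ, Fintype.card_fin, nsmul_eq_mul, mul_one, ← two_mul]
  ring

theorem log_two_mul_div_le_logSumExpPenalty {d : ℕ} {M : ℝ} (hM : 0 < M) (v : Fin d → ℝ) :
    Real.log (2 * d) / M ≤ logSumExpPenalty d M v := by
  rcases Nat.eq_zero_or_pos d with rfl | hd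
  · simp [logSumExpPenalty]
  have hd' : (0 : ℝ) < d := Nat.cast_pos.mpr hd
  have hsum : (2 * d : ℝ) ≤ ∑ i, Real.exp (M * v i) + ∑ i, Real.exp (-(M * v i)) := by
    rw [← Finset.sum_add_distrib]
    calc (2 * d : ℝ) = ∑ _i : Fin d, (2 : ℝ) := by simp [mul_comm]
      _ ≤ _ := Finset.sum_le_sum fun i _ => by
        have h := Real.one_le_cosh (M * v i)
        rw [Real.cosh_eq] at h
        linarith
  rw [logSumExpPenalty, div_eq_mul_one_div, mul_comm]
  gcongr

theorem norm_le_logSumExpPenalty {d : ℕ} {M : ℝ} (hM : 0 < M) (v : Fin d → ℝ) :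
    ‖v‖ ≤ logSumExpPenalty d M v := by
  rcases Nat.eq_zero_or_pos d with rfl | hd
  · simp [logSumExpPenalty, Subsingleton.elim v 0]
  have : Nonempty (Fin d) := ⟨⟨0, hd⟩⟩
  refine (pi_norm_le_iff_of_nonempty v).mpr fun i => ?_
  rw [logSumExpPenalty, one_div, inv_mul_eq_div, le_div_iff₀ hM, Real.norm_eq_abs]
  have hpos : 0 ≤ ∑ j, Real.exp (M * v j) := by positivity
  have hneg : 0 ≤ ∑ j, Real.exp (-(M * v j)) := by positivity
  have hpos_le : Real.exp (M * v i) ≤ ∑ j, Real.exp (M * v j) :=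
    Finset.single_le_sum (f := fun j => Real.exp (M * v j))
      (fun j _ => (Real.exp_pos _).le) (Finset.mem_univ i)
  have hneg_le : Real.exp (-(M * v i)) ≤ ∑ j, Real.exp (-(M * v j)) :=
    Finset.single_le_sum (f := fun j => Real.exp (-(M * v j)))
      (fun j _ => (Real.exp_pos _).le) (Finset.mem_univ i)
  rw [Real.le_log_iff_exp_le (by linarith [Real.exp_pos (M * v i)])]
  rcases abs_cases (v i) with ⟨h, -⟩ | ⟨h, -⟩ <;> rw [h]
  · rw [mul_comm]
    linarith
  · rw [neg_mul, mul_comm]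
    linarith

theorem sum_mul_le_sum_abs_mul_norm {ι : Type*} [Fintype ι] (y v : ι → ℝ) :
    ∑ i, y i * v i ≤ (∑ i, |y i|) * ‖v‖ := by
  rw [Finset.sum_mul]
  refine Finset.sum_le_sum fun i _ => (le_abs_self _).trans ?_
  rw [abs_mul]
  exact mul_le_mul_of_nonneg_left (norm_le_pi_norm v i) (abs_nonneg _)

/-- **Suboptimality and infeasibility of an ε-optimal solution of the penalized problem.**
Let `𝒜(X) = (⟨A₁,X⟩, …, ⟨A_d,X⟩)`, let `X⋆ ⪰ 0` be primal feasible (`𝒜(X⋆) = b`,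
`Tr X⋆ ≤ α`), and let `y⋆` satisfy the Lagrangian optimality condition
`⟨C,X⟩ - ⟨y⋆, 𝒜(X) - b⟩ ≤ ⟨C,X⋆⟩` for every `X ⪰ 0`.  If `β > ‖y⋆‖₁` and `X̂ ⪰ 0` with
`Tr X̂ ≤ α` is `ε`-optimal for the LogSumExp-penalized problem, then
(i) `⟨C,X̂⟩ ≥ ⟨C,X⋆⟩ - ε`;
(ii) `‖𝒜(X̂) - b‖_∞ ≤ (β log(2d)/M + ε)/(β - ‖y⋆‖₁)`;
(iii) `⟨C,X̂⟩ ≤ ⟨C,X⋆⟩ + ‖y⋆‖₁ (β log(2d)/M + ε)/(β - ‖y⋆‖₁)`.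
(The norm on `Fin d → ℝ` is the sup norm.) -/
theorem penalized_sdp_subopt_feas {n d : ℕ}
    (C : Matrix (Fin n) (Fin n) ℝ) (A : Fin d → Matrix (Fin n) (Fin n) ℝ)
    (hC : C.IsSymm) (hA : ∀ i, (A i).IsSymm)
    (b : Fin d → ℝ) (α : ℝ) (hα : 0 < α)
    (Xstar : Matrix (Fin n) (Fin n) ℝ) (hXstar : Xstar.PosSemidef)
    (hXstar_feas : (fun i => traceInner (A i) Xstar) = b)
    (hXstar_tr : Xstar.trace ≤ α)
    (ystar : Fin d → ℝ)
    (hLagrange : ∀ X : Matrix (Fin n) (Fin n) ℝ, X.PosSemidef →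
      traceInner C X - ∑ i, ystar i * (traceInner (A i) X - b i) ≤ traceInner C Xstar)
    (M ε β : ℝ) (hM : 0 < M) (hε : 0 ≤ ε) (hβ : ∑ i, |ystar i| < β)
    (Xhat : Matrix (Fin n) (Fin n) ℝ) (hXhat : Xhat.PosSemidef) (hXhat_tr : Xhat.trace ≤ α)
    (hXhat_opt : ∀ X : Matrix (Fin n) (Fin n) ℝ, X.PosSemidef → X.trace ≤ α →
      traceInner C Xhat - β * logSumExpPenalty d M (fun i => traceInner (A i) Xhat - b i) ≥
        traceInner C X - β * logSumExpPenalty d M (fun i => traceInner (A i) X - b i) - ε) :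
    traceInner C Xhat ≥ traceInner C Xstar - ε ∧
      ‖(fun i => traceInner (A i) Xhat - b i)‖ ≤
        (β * Real.log (2 * d) / M + ε) / (β - ∑ i, |ystar i|) ∧
      traceInner C Xhat ≤ traceInner C Xstar +
        (∑ i, |ystar i|) * (β * Real.log (2 * d) / M + ε) / (β - ∑ i, |ystar i|) := by
  subst hXstar_feas
  have hs : 0 ≤ ∑ i, |ystar i| := Finset.sum_nonneg fun i _ => abs_nonneg _
  have hopt := hXhat_opt Xstar hXstar hXstar_tr
  have hlag := hLagrange Xhat hXhat
  simp only [sub_self, logSumExpPenalty_zero] at hopt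
  set v : Fin d → ℝ := fun i => traceInner (A i) Xhat - traceInner (A i) Xstar
  have hdual : ∑ i, ystar i * (traceInner (A i) Xhat - traceInner (A i) Xstar)
      ≤ (∑ i, |ystar i|) * ‖v‖ := sum_mul_le_sum_abs_mul_norm ystar v
  have hlog := mul_le_mul_of_nonneg_left (log_two_mul_div_le_logSumExpPenalty hM v)
    (hs.trans hβ.le)
  have hnorm := mul_le_mul_of_nonneg_left (norm_le_logSumExpPenalty hM v) (hs.trans hβ.le)
  have hfeas : ‖v‖ ≤ (β * Real.log (2 * d) / M + ε) / (β - ∑ i, |ystar i|) := by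
    rw [le_div_iff₀ (sub_pos.mpr hβ), mul_div_assoc]
    linarith
  refine ⟨by linarith, hfeas, ?_⟩
  rw [mul_div_assoc]
  linarith [mul_le_mul_of_nonneg_left hfeas hs]
end

section
/- Let C be a symmetric positive semidefinite n×n real matrix, let ε ∈ (0, 1/2), and let θ ≥ 0. Let X̂ be a symmetric positive semidefinite n×n matrix with 0 < max_i X̂_ii ≤ 1 + ε and ⟨C,X̂⟩ ≥ (1 − ε)·θ. With m = max_i X̂_ii, define X̄ = X̂/m + (I − diag*(diag(X̂))/m). Then ⟨C,X̄⟩ ≥ (1 − 2ε)·θ. -/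
theorem traceInner_add {n : ℕ} (A B D : Matrix (Fin n) (Fin n) ℝ) :
    traceInner A (B + D) = traceInner A B + traceInner A D := by
  simp [traceInner, Matrix.mul_add]

theorem traceInner_smul {n : ℕ} (c : ℝ) (A B : Matrix (Fin n) (Fin n) ℝ) :
    traceInner A (c • B) = c * traceInner A B := by
  simp [traceInner]

theorem traceInner_diagonal {n : ℕ} (A : Matrix (Fin n) (Fin n) ℝ) (d : Fin n → ℝ) :
    traceInner A (Matrix.diagonal d) = ∑ i, A i i * d i := by
  simp [traceInner, Matrix.trace]

/-- **Objective value of the rounding matrix.**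
Let `C ⪰ 0`, `ε ∈ (0, 1/2)`, `θ ≥ 0`, and let `X̂ ⪰ 0` have largest diagonal entry
`m` with `0 < m ≤ 1 + ε` and `⟨C, X̂⟩ ≥ (1-ε)θ`.  Then the rounding matrix
`X̄ = X̂/m + (I - diag*(diag X̂)/m)` satisfies `⟨C, X̄⟩ ≥ (1-2ε)θ`. -/
theorem rounding_matrix_objective {n : ℕ}
    (C : Matrix (Fin n) (Fin n) ℝ) (hC : C.PosSemidef)
    (ε : ℝ) (hε : ε ∈ Set.Ioo (0:ℝ) (1/2)) (θ : ℝ) (hθ : 0 ≤ θ)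
    (Xhat : Matrix (Fin n) (Fin n) ℝ) (hXhat : Xhat.PosSemidef)
    (m : ℝ) (hm_greatest : IsGreatest {r | ∃ i, r = Xhat i i} m)
    (hm_pos : 0 < m) (hm_le : m ≤ 1 + ε)
    (hobj : traceInner C Xhat ≥ (1 - ε) * θ) :
    traceInner C (m⁻¹ • Xhat + ((1 : Matrix (Fin n) (Fin n) ℝ) -
        m⁻¹ • Matrix.diagonal (fun i => Xhat i i))) ≥ (1 - 2 * ε) * θ := by
  obtain ⟨hε0, hε1⟩ := hε
  have hslack : (1 : Matrix (Fin n) (Fin n) ℝ) - m⁻¹ • Matrix.diagonal (fun i => Xhat i i) =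
      Matrix.diagonal (fun i => 1 - m⁻¹ * Xhat i i) := by
    rw [← Matrix.diagonal_one, ← Matrix.diagonal_smul, Matrix.diagonal_sub]
    rfl
  have hslack_nonneg : 0 ≤ ∑ i, C i i * (1 - m⁻¹ * Xhat i i) := by
    refine Finset.sum_nonneg fun i _ => mul_nonneg hC.diag_nonneg (sub_nonneg.2 ?_)
    rw [inv_mul_le_one₀ hm_pos]
    exact hm_greatest.2 ⟨i, rfl⟩
  have hscaled : (1 - 2 * ε) * θ ≤ m⁻¹ * traceInner C Xhat := by
    rw [le_inv_mul_iff₀ hm_pos]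
    have hfactor : m * (1 - 2 * ε) ≤ 1 - ε := by nlinarith
    calc m * ((1 - 2 * ε) * θ) = m * (1 - 2 * ε) * θ := by ring
      _ ≤ (1 - ε) * θ := mul_le_mul_of_nonneg_right hfactor hθ
      _ ≤ traceInner C Xhat := hobj
  rw [hslack, traceInner_add, traceInner_smul, traceInner_diagonal]
  linarith
end

section
/- Let G be a chordal simple graph on vertex set {1,…,n} and let α > 0. A matrix X ∈ S_G is an extreme point of S_G if and only if X = 0 or X = uuᵀ for some u ∈ ℝ^n with ‖u‖² = α such that the set of indices of nonzero entries of u is a clique of G. -/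
/-- A cycle `p` in a simple graph `G` has a chord if some edge of `G` joins two vertices of
the cycle but is not itself an edge of the cycle. -/
def SimpleGraph.Walk.HasChord {V : Type*} {G : SimpleGraph V} {v : V} (p : G.Walk v v) :
    Prop :=
  ∃ a b, G.Adj a b ∧ a ∈ p.support ∧ b ∈ p.support ∧ s(a, b) ∉ p.edges

/-- A simple graph is chordal if every cycle of length at least four has a chord. -/
def SimpleGraph.IsChordalGraph {V : Type*} (G : SimpleGraph V) : Prop :=
  ∀ (v : V) (p : G.Walk v v), p.IsCycle → 4 ≤ p.length → p.HasChord

/-- The spectrahedron `S_G = {X ⪰ 0 : Tr X ≤ α, X i j = 0 whenever i ≠ j and {i,j} ∉ E(G)}`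
of positive semidefinite matrices sparse with respect to a graph `G`. -/
def graphSpectrahedron (n : ℕ) (G : SimpleGraph (Fin n)) (α : ℝ) :
    Set (Matrix (Fin n) (Fin n) ℝ) :=
  {X | X.PosSemidef ∧ X.trace ≤ α ∧ ∀ i j, i ≠ j → ¬G.Adj i j → X i j = 0}

namespace SimpleGraph

variable {V : Type*} {G : SimpleGraph V}

theorem spanningCoe_induce_adj {s : Set V} {a b : V} :
    (G.induce s).spanningCoe.Adj a b ↔ G.Adj a b ∧ a ∈ s ∧ b ∈ s := by
  simp [and_left_comm, and_comm, and_assoc]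

theorem Walk.mem_edges_of_length_eq_dist {u v : V} (p : G.Walk u v)
    (hp : p.length = G.dist u v) {a b : V} (ha : a ∈ p.support) (hb : b ∈ p.support)
    (hab : G.Adj a b) : s(a, b) ∈ p.edges := by
  rw [Walk.mem_support_iff_exists_getVert] at ha hb
  obtain ⟨i, rfl, hi⟩ := ha
  obtain ⟨j, rfl, hj⟩ := hb
  wlog hij : i ≤ j generalizing i j
  · rw [Sym2.eq_swap]
    exact this j hj i hi hab.symm (le_of_not_ge hij)
  have hne : i ≠ j := by rintro rfl; exact hab.ne rfl
  by_cases hsucc : j = i + 1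
  · subst hsucc
    rw [Walk.edges, List.mem_map]
    exact ⟨_, List.getElem_mem (by simpa using hj : i < p.darts.length), by
      rw [Walk.darts_getElem_eq_getVert]; rfl⟩
  · have := dist_le (((p.take i).concat hab).append (p.drop j))
    simp only [Walk.length_append, Walk.length_concat, Walk.take_length, Walk.drop_length] at this
    omega

/-- In a chordal graph, two neighbours of `x` that are joined by a path whose interior avoids the
closed neighbourhood of `x` are adjacent. -/
theorem IsChordalGraph.adj_of_reachable (hG : G.IsChordalGraph) {R : Set V} {x a b c d : V}
    (hR : ∀ r ∈ R, r ≠ x ∧ ¬G.Adj x r) (ha : G.Adj x a) (hb : G.Adj x b) (hab : a ≠ b)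
    (hac : G.Adj a c) (hbd : G.Adj b d) (hc : c ∈ R) (hd : d ∈ R)
    (hcd : (G.induce R).spanningCoe.Reachable c d) : G.Adj a b := by
  by_contra hnab
  set H := (G.induce (insert a (insert b R))).spanningCoe
  have hHG : H ≤ G := fun u v h => (spanningCoe_induce_adj.1 h).1
  have hRH : (G.induce R).spanningCoe ≤ H := fun u v h => by
    obtain ⟨h, hu, hv⟩ := spanningCoe_induce_adj.1 h
    exact spanningCoe_induce_adj.2 ⟨h, by simp [hu], by simp [hv]⟩
  have hHac : H.Adj a c := spanningCoe_induce_adj.2 ⟨hac, by simp, by simp [hc]⟩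
  have hHbd : H.Adj d b := spanningCoe_induce_adj.2 ⟨hbd.symm, by simp [hd], by simp⟩
  have hreach : H.Reachable a b := (hHac.reachable.trans (hcd.mono hRH)).trans hHbd.reachable
  obtain ⟨p, hp, hlen⟩ := hreach.exists_path_of_dist
  have hlen2 : 2 ≤ p.length := by
    rcases hl : p.length with _ | _ | k
    · exact (hab (Walk.eq_of_length_eq_zero hl)).elim
    · exact (hnab (hHG (Walk.adj_of_length_eq_one hl))).elim
    · omega
  have hsupp : ∀ v ∈ p.support, v = a ∨ v = b ∨ v ∈ R := by
    intro v hv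
    rw [Walk.mem_support_iff_exists_getVert] at hv
    obtain ⟨i, rfl, hi⟩ := hv
    rcases hi.lt_or_eq with hi | rfl
    · have := (spanningCoe_induce_adj.1 (p.adj_getVert_succ hi)).2.1
      simpa using this
    · simp
  have hx : x ∉ p.support := fun h => by
    rcases hsupp x h with rfl | rfl | h
    · exact ha.ne rfl
    · exact hb.ne rfl
    · exact (hR x h).1 rfl
  have hxs : ∀ v ∈ p.support, G.Adj x v → v = a ∨ v = b := fun v hv hxv => by
    rcases hsupp v hv with h | h | h
    · exact .inl h
    · exact .inr h
    · exact ((hR v h).2 hxv).elim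
  let q : G.Walk a x := (p.mapLe hHG).concat hb.symm
  have hcyc : (Walk.cons ha q).IsCycle := by
    rw [Walk.cons_isCycle_iff]
    refine ⟨(Walk.isPath_mapLe hHG |>.2 hp).concat (by simpa using hx) _, fun h => ?_⟩
    simp only [q, Walk.edges_concat, Walk.edges_mapLe_eq_edges, List.concat_eq_append,
      List.mem_append, List.mem_singleton] at h
    rcases h with h | h
    · exact hx (p.fst_mem_support_of_mem_edges h)
    · rw [Sym2.eq_iff] at h
      rcases h with ⟨h, -⟩ | ⟨-, h⟩
      · exact hb.ne h
      · exact hab h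
  obtain ⟨u, v, huv, hu, hv, he⟩ := hG x _ hcyc (by simp [q]; omega)
  have hmem : ∀ w, w ∈ (Walk.cons ha q).support → w = x ∨ w ∈ p.support := by
    intro w hw
    simp only [q, Walk.support_cons, Walk.support_concat, Walk.support_mapLe_eq_support] at hw
    simp at hw
    tauto
  have hedge : ∀ e, e = s(x, a) ∨ e ∈ p.edges ∨ e = s(b, x) → e ∈ (Walk.cons ha q).edges := by
    intro e h
    simp only [q, Walk.edges_cons, Walk.edges_concat, Walk.edges_mapLe_eq_edges]
    simpa using h
  rcases hmem u hu with rfl | hup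
  · rcases hmem v hv with rfl | hvp
    · exact huv.ne rfl
    · rcases hxs v hvp huv with rfl | rfl
      · exact he (hedge _ (by simp))
      · exact he (hedge _ (by simp [Sym2.eq_swap]))
  · rcases hmem v hv with rfl | hvp
    · rcases hxs u hup huv.symm with rfl | rfl
      · exact he (hedge _ (by simp [Sym2.eq_swap]))
      · exact he (hedge _ (by simp))
    · refine he (hedge _ (.inr (.inl (p.mem_edges_of_length_eq_dist hlen hup hvp ?_))))
      refine spanningCoe_induce_adj.2 ⟨huv, ?_, ?_⟩
      · simpa using hsupp u hup
      · simpa using hsupp v hvp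

/-- Dirac's theorem, relative to a finite vertex set `S`: every vertex of `S` that is not adjacent
to all others has a non-neighbour whose neighbourhood in `S` is a clique. -/
theorem IsChordalGraph.exists_simplicial_not_adj (hG : G.IsChordalGraph) (S : Finset V) :
    ∀ x ∈ S, (∃ y ∈ S, y ≠ x ∧ ¬G.Adj x y) →
      ∃ z ∈ S, z ≠ x ∧ ¬G.Adj x z ∧ G.IsClique {w | w ∈ S ∧ G.Adj z w} := by
  classical
  induction S using Finset.strongInduction with
  | H S ih =>
  rintro x hx ⟨y, hy, hyx, hxy⟩
  set R : Set V := {r | r ∈ S ∧ r ≠ x ∧ ¬G.Adj x r}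
  set C : Set V := {r | r ∈ R ∧ (G.induce R).spanningCoe.Reachable y r}
  set T : Set V := {t | t ∈ S ∧ t ∉ C ∧ ∃ c ∈ C, G.Adj t c}
  have hyC : y ∈ C := ⟨⟨hy, hyx, hxy⟩, .refl _⟩
  have hTx : ∀ t ∈ T, G.Adj x t := by
    rintro t ⟨htS, htC, c, hc, htc⟩
    by_contra hxt
    have htx : t ≠ x := by rintro rfl; exact hc.1.2.2 htc
    have htR : t ∈ R := ⟨htS, htx, hxt⟩
    exact htC ⟨htR, hc.2.trans (Adj.reachable (spanningCoe_induce_adj.2 ⟨htc.symm, hc.1, htR⟩))⟩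
  have hTT : ∀ s ∈ T, ∀ t ∈ T, s ≠ t → G.Adj s t := by
    intro s hs t ht hst
    obtain ⟨-, -, c, hc, hsc⟩ := id hs
    obtain ⟨-, -, d, hd, htd⟩ := id ht
    exact hG.adj_of_reachable (R := R) (fun r hr => hr.2) (hTx s hs) (hTx t ht) hst hsc htd
      hc.1 hd.1 (hc.2.symm.trans hd.2)
  have hnb : ∀ c ∈ C, ∀ w ∈ S, G.Adj c w → w ∈ C ∨ w ∈ T := by
    intro c hc w hw hcw
    by_cases h : w ∈ C
    · exact .inl h
    · exact .inr ⟨hw, h, c, hc, hcw.symm⟩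
  set S' := S.filter (fun w => w ∈ C ∨ w ∈ T) with hS'
  have hmemS' : ∀ w, w ∈ S' ↔ w ∈ C ∨ w ∈ T := by
    intro w
    rw [hS', Finset.mem_filter]
    exact ⟨And.right, fun h => ⟨h.elim (fun h => h.1.1) (fun h => h.1), h⟩⟩
  have hss : S' ⊂ S := by
    refine Finset.filter_ssubset.2 ⟨x, hx, ?_⟩
    rintro (h | h)
    · exact h.1.2.1 rfl
    · exact (hTx x h).ne rfl
  suffices ∃ z ∈ C, G.IsClique {w | w ∈ S' ∧ G.Adj z w} by
    obtain ⟨z, hz, hcl⟩ := this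
    refine ⟨z, hz.1.1, hz.1.2.1, hz.1.2.2, IsClique.subset (fun w hw => ?_) hcl⟩
    exact ⟨(hmemS' w).2 (hnb z hz w hw.1 hw.2), hw.2⟩
  by_cases hcomp : ∃ t ∈ T, ∃ w ∈ S', w ≠ t ∧ ¬G.Adj t w
  · obtain ⟨t, ht, hw⟩ := hcomp
    obtain ⟨z, hz, hzt, htz, hcl⟩ := ih S' hss t ((hmemS' t).2 (.inr ht)) hw
    refine ⟨z, ((hmemS' z).1 hz).resolve_right fun hzT => ?_, hcl⟩
    exact htz (hTT t ht z hzT hzt.symm)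
  push Not at hcomp
  by_cases hall : ∃ c ∈ S', ∃ w ∈ S', w ≠ c ∧ ¬G.Adj c w
  · obtain ⟨c, hc, hw⟩ := hall
    obtain ⟨z, hz, hzc, hcz, hcl⟩ := ih S' hss c hc hw
    refine ⟨z, ((hmemS' z).1 hz).resolve_right fun hzT => ?_, hcl⟩
    exact hcz (hcomp z hzT c hc hzc.symm).symm
  · push Not at hall
    exact ⟨y, hyC, fun a ha b hb hab => hall a ha.1 b hb.1 hab.symm⟩

theorem IsChordalGraph.exists_simplicial (hG : G.IsChordalGraph) {S : Finset V}
    (hS : S.Nonempty) : ∃ z ∈ S, G.IsClique {w | w ∈ S ∧ G.Adj z w} := by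
  obtain ⟨x, hx⟩ := hS
  by_cases h : ∃ x ∈ S, ∃ y ∈ S, y ≠ x ∧ ¬G.Adj x y
  · obtain ⟨x, hx, h⟩ := h
    obtain ⟨z, hz, -, -, hcl⟩ := hG.exists_simplicial_not_adj S x hx h
    exact ⟨z, hz, hcl⟩
  · push Not at h
    exact ⟨x, hx, fun a ha b hb hab => h a ha.1 b hb.1 hab.symm⟩

end SimpleGraph

namespace Matrix

variable {ι : Type*} [Fintype ι]

theorem PosSemidef.apply_eq_zero_of_diag_eq_zero {X : Matrix ι ι ℝ} (hX : X.PosSemidef) {i : ι}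
    (hi : X i i = 0) (j : ι) : X j i = 0 := by
  classical
  have h := (hX.dotProduct_mulVec_zero_iff (Pi.single i 1)).1 (by simpa using hi)
  simpa using congrFun h j

/-- Subtracting from a positive semidefinite matrix the normalized outer square of one of its
columns leaves a positive semidefinite matrix. -/
theorem PosSemidef.sub_vecMulVec_col {X : Matrix ι ι ℝ} (hX : X.PosSemidef) (i : ι) :
    (X - (X i i)⁻¹ • vecMulVec (X.col i) (X.col i)).PosSemidef := by
  classical
  have hsymm : Xᵀ = X := by simpa using hX.isHermitian.eq
  refine .of_dotProduct_mulVec_nonneg ?_ fun y => ?_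
  · ext a b
    simp [vecMulVec_apply, mul_comm, ← congrFun (congrFun hsymm a) b]
  by_cases hi : X i i = 0
  · simpa [hi] using hX.dotProduct_mulVec_nonneg y
  have hrow : X.row i = X.col i := by
    ext j
    exact congrFun (congrFun hsymm j) i
  have h := hX.dotProduct_mulVec_nonneg (y - ((X i i)⁻¹ * (X.col i ⬝ᵥ y)) • Pi.single i 1)
  have h1 : y ⬝ᵥ X.col i = X.col i ⬝ᵥ y := dotProduct_comm _ _
  have h2 : (X *ᵥ y) i = X.col i ⬝ᵥ y := by rw [← hrow]; rfl
  simp only [star_trivial, mulVec_sub, mulVec_smul, mulVec_single_one, sub_dotProduct,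
    dotProduct_sub, smul_dotProduct, dotProduct_smul, single_one_dotProduct, smul_eq_mul, h1, h2,
    sub_mulVec, smul_mulVec, vecMulVec_mulVec, op_smul_eq_smul, col_apply] at h ⊢
  refine h.trans_eq ?_
  field_simp
  ring

theorem trace_vecMulVec_self (u : ι → ℝ) : (vecMulVec u u).trace = ∑ i, u i ^ 2 := by
  simp [trace, vecMulVec_apply, sq]

/-- A positive semidefinite matrix whose quadratic form vanishes on the orthogonal complement of
`u` is a multiple of `u uᵀ`. -/
theorem PosSemidef.eq_vecMulVec_of_forall_orthogonal {A : Matrix ι ι ℝ} (hA : A.PosSemidef)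
    {u : ι → ℝ} (hu : 0 < u ⬝ᵥ u) (h : ∀ y, u ⬝ᵥ y = 0 → y ⬝ᵥ A *ᵥ y = 0)
    (htr : A.trace = u ⬝ᵥ u) : A = vecMulVec u u := by
  classical
  have hsymm : ∀ i j, A i j = A j i := fun i j => by
    simpa using (congrFun (congrFun hA.isHermitian.eq i) j).symm
  have hcol : ∀ i j, (u ⬝ᵥ u) * A i j = (A *ᵥ u) i * u j := by
    intro i j
    have h0 : u ⬝ᵥ ((u ⬝ᵥ u) • Pi.single j 1 - u j • u) = 0 := by
      simp [dotProduct_sub, mul_comm]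
    have h1 := congrFun ((hA.dotProduct_mulVec_zero_iff _).1 (by simpa only [star_trivial] using h _ h0)) i
    simp [mulVec_sub, mulVec_smul] at h1
    linarith
  have hAu : ∀ i, (u ⬝ᵥ u) * (A *ᵥ u) i = (u ⬝ᵥ A *ᵥ u) * u i := by
    intro i
    have : ∀ j, (A *ᵥ u) i * (u j * u j) = u j * (A *ᵥ u) j * u i := fun j => by
      have h1 := hcol i j
      rw [hsymm, hcol j i] at h1
      linear_combination -u j * h1
    simp only [dotProduct, Finset.sum_mul]
    exact Finset.sum_congr rfl fun j _ => by linarith [this j]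
  have hAij : ∀ i j, (u ⬝ᵥ u) ^ 2 * A i j = (u ⬝ᵥ A *ᵥ u) * (u i * u j) := fun i j => by
    linear_combination (u ⬝ᵥ u) * hcol i j + u j * hAu i
  have hk : u ⬝ᵥ A *ᵥ u = (u ⬝ᵥ u) ^ 2 := by
    have h1 : (u ⬝ᵥ u) ^ 2 * A.trace = (u ⬝ᵥ A *ᵥ u) * (u ⬝ᵥ u) := by
      rw [trace, Finset.mul_sum]
      conv_rhs => rw [dotProduct.eq_1 u u, Finset.mul_sum]
      exact Finset.sum_congr rfl fun i _ => hAij i i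
    rw [htr] at h1
    exact (mul_right_cancel₀ hu.ne' h1).symm
  ext i j
  have h1 := hAij i j
  rw [hk] at h1
  exact mul_left_cancel₀ (pow_pos hu 2).ne' h1

end Matrix

/-- A nonzero positive semidefinite matrix with chordal sparsity pattern dominates a nonzero
rank-one matrix supported on a clique. -/
theorem exists_clique_vecMulVec_le {V : Type*} [Fintype V] {G : SimpleGraph V}
    (hG : G.IsChordalGraph) {X : Matrix V V ℝ} (hX : X.PosSemidef) (h0 : X ≠ 0)
    (hsp : ∀ i j, i ≠ j → ¬G.Adj i j → X i j = 0) :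
    ∃ u : V → ℝ, 0 < ∑ i, u i ^ 2 ∧ G.IsClique {i | u i ≠ 0} ∧
      (X - Matrix.vecMulVec u u).PosSemidef := by
  classical
  have hS : (Finset.univ.filter fun i => X i i ≠ 0).Nonempty := by
    by_contra h
    simp only [Finset.not_nonempty_iff_eq_empty, Finset.filter_eq_empty_iff, Finset.mem_univ,
      true_imp_iff, not_not] at h
    exact h0 (Matrix.ext fun i j => hX.apply_eq_zero_of_diag_eq_zero (@h j) i)
  obtain ⟨v, hv, hcl⟩ := hG.exists_simplicial hS
  simp only [Finset.mem_filter, Finset.mem_univ, true_and] at hv hcl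
  have hpos : 0 < X v v := lt_of_le_of_ne hX.diag_nonneg hv.symm
  have hsqrt : 0 < √(X v v) := Real.sqrt_pos.2 hpos
  have hsymm : ∀ i j, X i j = X j i := fun i j => by
    simpa using (congrFun (congrFun hX.isHermitian.eq i) j).symm
  have hsupp : ∀ i, X i v ≠ 0 → i ≠ v → X i i ≠ 0 ∧ G.Adj v i := by
    refine fun i hi hiv => ⟨fun h => hi ?_, ?_⟩
    · rw [hsymm]
      exact hX.apply_eq_zero_of_diag_eq_zero h v
    · by_contra h
      exact hi (hsp i v hiv fun h' => h h'.symm)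
  refine ⟨(√(X v v))⁻¹ • X.col v, ?_, ?_, ?_⟩
  · refine Finset.sum_pos' (fun i _ => sq_nonneg _) ⟨v, Finset.mem_univ v, ?_⟩
    simp only [Pi.smul_apply, Matrix.col_apply, smul_eq_mul]
    positivity
  · intro a ha b hb hab
    have ha' : X a v ≠ 0 := right_ne_zero_of_mul ha
    have hb' : X b v ≠ 0 := right_ne_zero_of_mul hb
    by_cases hav : a = v
    · subst hav
      exact (hsupp b hb' hab.symm).2
    by_cases hbv : b = v
    · subst hbv
      exact (hsupp a ha' hab).2.symm
    · exact hcl (hsupp a ha' hav) (hsupp b hb' hbv) hab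
  · convert hX.sub_vecMulVec_col v using 2
    rw [Matrix.smul_vecMulVec, Matrix.vecMulVec_smul, smul_smul, ← mul_inv,
      Real.mul_self_sqrt hpos.le]

theorem smul_mem_graphSpectrahedron {n : ℕ} {G : SimpleGraph (Fin n)} {α c : ℝ}
    {X : Matrix (Fin n) (Fin n) ℝ} (hX : X.PosSemidef)
    (hsp : ∀ i j, i ≠ j → ¬G.Adj i j → X i j = 0) (hc : 0 ≤ c) (htr : c * X.trace ≤ α) :
    c • X ∈ graphSpectrahedron n G α :=
  ⟨hX.smul hc, by simpa using htr, fun i j hij h => by simp [hsp i j hij h]⟩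

theorem vecMulVec_apply_eq_zero_of_isClique {V : Type*} {G : SimpleGraph V} {u : V → ℝ}
    (hu : G.IsClique {i | u i ≠ 0}) (i j : V) (hij : i ≠ j) (h : ¬G.Adj i j) :
    Matrix.vecMulVec u u i j = 0 := by
  rw [Matrix.vecMulVec_apply]
  by_contra h0
  exact h (hu (left_ne_zero_of_mul h0) (right_ne_zero_of_mul h0) hij)

/-- A nonzero extreme point of the spectrahedron is a multiple, of trace `α`, of any sparse
positive semidefinite matrix it dominates. -/
theorem eq_smul_of_mem_extremePoints {n : ℕ} {G : SimpleGraph (Fin n)} {α : ℝ} (hα : 0 < α)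
    {X Y : Matrix (Fin n) (Fin n) ℝ} (hX : X ∈ (graphSpectrahedron n G α).extremePoints ℝ)
    (hY : Y.PosSemidef) (hYsp : ∀ i j, i ≠ j → ¬G.Adj i j → Y i j = 0) (htr : 0 < Y.trace)
    (hXY : (X - Y).PosSemidef) : X = (α / Y.trace) • Y := by
  obtain ⟨⟨hXp, hXt, hXsp⟩, hext⟩ := mem_extremePoints_iff_left.1 hX
  have hs : 0 ≤ (X - Y).trace := hXY.trace_nonneg
  set t := Y.trace
  set s := (X - Y).trace
  have hts : t + s = X.trace := by simp [t, s]
  -- `X` is a convex combination of a multiple of `Y` and a multiple of `X - Y`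
  have hA : (α / t) • Y ∈ graphSpectrahedron n G α :=
    smul_mem_graphSpectrahedron hY hYsp (by positivity) (by
      rw [div_mul_cancel₀ _ htr.ne'])
  rcases (show t ≤ α by linarith).lt_or_eq with hlt | heq
  · have hd : 0 < α - t := by linarith
    have hB : (α / (α - t)) • (X - Y) ∈ graphSpectrahedron n G α := by
      refine smul_mem_graphSpectrahedron hXY
        (fun i j hij h => by simp [hXsp i j hij h, hYsp i j hij h]) (by positivity) ?_
      rw [div_mul_eq_mul_div, div_le_iff₀ hd]
      exact mul_le_mul_of_nonneg_left (by linarith) hα.le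
    refine (hext _ hA _ hB ⟨t / α, (α - t) / α, by positivity, by positivity, by field_simp; ring,
      ?_⟩).symm
    rw [smul_smul, smul_smul, div_mul_div_cancel₀ hα.ne', div_mul_div_cancel₀ hα.ne',
      div_self htr.ne', div_self hd.ne', one_smul, one_smul, add_sub_cancel]
  · have h0 : X - Y = 0 := hXY.trace_eq_zero_iff.1 (by linarith)
    rw [heq, div_self hα.ne', one_smul]
    exact sub_eq_zero.1 h0

theorem zero_mem_extremePoints_graphSpectrahedron {n : ℕ} {G : SimpleGraph (Fin n)} {α : ℝ}
    (h0 : 0 ∈ graphSpectrahedron n G α) :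
    0 ∈ (graphSpectrahedron n G α).extremePoints ℝ := by
  refine mem_extremePoints_iff_left.2 ⟨h0, ?_⟩
  rintro A hA B hB ⟨a, b, ha, hb, -, h⟩
  have htr := congrArg Matrix.trace h
  simp only [Matrix.trace_add, Matrix.trace_smul, smul_eq_mul, Matrix.trace_zero] at htr
  have h1 := hA.1.trace_nonneg
  have h2 := mul_nonneg hb.le hB.1.trace_nonneg
  exact hA.1.trace_eq_zero_iff.1 (by nlinarith)

theorem vecMulVec_mem_extremePoints_graphSpectrahedron {n : ℕ} {G : SimpleGraph (Fin n)} {α : ℝ}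
    (hα : 0 < α) {u : Fin n → ℝ} (hu : ∑ i, u i ^ 2 = α)
    (hmem : Matrix.vecMulVec u u ∈ graphSpectrahedron n G α) :
    Matrix.vecMulVec u u ∈ (graphSpectrahedron n G α).extremePoints ℝ := by
  refine mem_extremePoints_iff_left.2 ⟨hmem, ?_⟩
  rintro A hA B hB ⟨a, b, ha, hb, hab, h⟩
  have huu : u ⬝ᵥ u = α := by simpa [dotProduct, sq] using hu
  have htr := congrArg Matrix.trace h
  simp only [Matrix.trace_add, Matrix.trace_smul, smul_eq_mul, Matrix.trace_vecMulVec_self,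
    hu] at htr
  refine hA.1.eq_vecMulVec_of_forall_orthogonal (huu ▸ hα) (fun y hy => ?_) ?_
  · have hq := congrArg (fun M => y ⬝ᵥ Matrix.mulVec M y) h
    simp only [Matrix.add_mulVec, Matrix.smul_mulVec, dotProduct_add, dotProduct_smul,
      Matrix.vecMulVec_mulVec, hy, MulOpposite.op_zero, zero_smul, dotProduct_zero,
      smul_eq_mul] at hq
    have h1 : 0 ≤ y ⬝ᵥ A.mulVec y := by simpa using hA.1.dotProduct_mulVec_nonneg y
    have h2 : 0 ≤ y ⬝ᵥ B.mulVec y := by simpa using hB.1.dotProduct_mulVec_nonneg y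
    nlinarith [mul_nonneg hb.le h2]
  · rw [huu]
    refine le_antisymm hA.2.1 (le_of_mul_le_mul_left ?_ ha)
    have h3 := mul_le_mul_of_nonneg_left hB.2.1 hb.le
    have h4 : a * α + b * α = α := by rw [← add_mul, hab, one_mul]
    linarith

/-- **Extreme points of a chordal-sparsity spectrahedron.**
Let `G` be a chordal graph on `{1, …, n}` and `α > 0`.  A matrix `X ∈ S_G` is an extreme
point of `S_G` if and only if `X = 0` or `X = uuᵀ` for some `u` with `‖u‖² = α` whose
support is a clique of `G`. -/
theorem chordal_spectrahedron_extremePoints {n : ℕ}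
    (G : SimpleGraph (Fin n)) (hG : G.IsChordalGraph) (α : ℝ) (hα : 0 < α)
    (X : Matrix (Fin n) (Fin n) ℝ) (hX : X ∈ graphSpectrahedron n G α) :
    X ∈ Set.extremePoints ℝ (graphSpectrahedron n G α) ↔
      X = 0 ∨ ∃ u : Fin n → ℝ, (∑ i, u i ^ 2) = α ∧
        G.IsClique {i | u i ≠ 0} ∧ X = Matrix.vecMulVec u u := by
  constructor
  · intro hext
    refine or_iff_not_imp_left.2 fun h0 => ?_
    obtain ⟨u, hu, hcl, hps⟩ := exists_clique_vecMulVec_le hG hX.1 h0 hX.2.2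
    have hY : (Matrix.vecMulVec u u).PosSemidef := by
      simpa using Matrix.posSemidef_vecMulVec_self_star u
    have htr := Matrix.trace_vecMulVec_self u
    have hXu := eq_smul_of_mem_extremePoints hα hext hY
      (vecMulVec_apply_eq_zero_of_isClique hcl) (htr ▸ hu) hps
    rw [htr] at hXu
    have hc : 0 ≤ α / ∑ i, u i ^ 2 := by positivity
    refine ⟨√(α / ∑ i, u i ^ 2) • u, ?_, hcl.subset fun i hi => right_ne_zero_of_mul hi, ?_⟩
    · simp only [Pi.smul_apply, smul_eq_mul, mul_pow, ← Finset.mul_sum, Real.sq_sqrt hc]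
      exact div_mul_cancel₀ _ hu.ne'
    · rw [Matrix.smul_vecMulVec, Matrix.vecMulVec_smul, smul_smul, Real.mul_self_sqrt hc, hXu]
  · rintro (rfl | ⟨u, hu, -, rfl⟩)
    · exact zero_mem_extremePoints_graphSpectrahedron hX
    · exact vecMulVec_mem_extremePoints_graphSpectrahedron hα hu hX
end

section
/- Let G be any simple graph on vertex set {1,…,n} and let α > 0. If u ∈ ℝ^n satisfies ‖u‖² = α and uuᵀ ∈ S_G, then uuᵀ is an extreme point of S_G. Moreover, 0 is an extreme point of S_G. -/
namespace Matrix.PosSemidef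

open scoped Matrix

variable {ι : Type*} [Fintype ι] [DecidableEq ι]

/-- A real positive semidefinite matrix whose quadratic form vanishes on the orthogonal complement
of `u` is a multiple of `u uᵀ`. -/
theorem smul_eq_trace_smul_vecMulVec {A : Matrix ι ι ℝ} (hA : A.PosSemidef) (u : ι → ℝ)
    (h : ∀ v : ι → ℝ, u ⬝ᵥ v = 0 → v ⬝ᵥ (A *ᵥ v) = 0) :
    (u ⬝ᵥ u) • A = A.trace • vecMulVec u u := by
  by_cases hs : u ⬝ᵥ u = 0
  · simp [dotProduct_self_eq_zero.mp hs]
  have key : ∀ i j, (u ⬝ᵥ u) * A i j = (A *ᵥ u) i * u j := by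
    intro i j
    have hv : u ⬝ᵥ ((u ⬝ᵥ u) • Pi.single j 1 - u j • u) = 0 := by
      simp [dotProduct_sub, mul_comm]
    have hAv := (hA.dotProduct_mulVec_zero_iff _).mp (by simpa only [star_trivial] using h _ hv)
    have hi := congrFun hAv i
    simp [mulVec_sub, mulVec_smul] at hi
    linarith
  have hsymm : ∀ i j, A i j = A j i := fun i j => by simpa using hA.isHermitian.apply j i
  have hu : ∀ i, (u ⬝ᵥ u) * (A *ᵥ u) i = ((A *ᵥ u) ⬝ᵥ u) * u i := by
    intro i
    simp only [mulVec, dotProduct] at key ⊢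
    rw [Finset.mul_sum, Finset.sum_mul]
    refine Finset.sum_congr rfl fun j _ => ?_
    linear_combination u j * key j i + u j * (∑ i, u i * u i) * hsymm i j
  have htr : (u ⬝ᵥ u) * A.trace = (A *ᵥ u) ⬝ᵥ u := by
    rw [trace, Finset.mul_sum]
    exact Finset.sum_congr rfl fun i _ => key i i
  ext i j
  refine mul_left_cancel₀ hs ?_
  simp only [smul_apply, vecMulVec_apply, smul_eq_mul]
  linear_combination (u ⬝ᵥ u) * key i j + u j * hu i - u i * u j * htr

/-- If a positive combination of two real positive semidefinite matrices is `u uᵀ`, then each of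
them is a multiple of `u uᵀ`. -/
theorem smul_eq_trace_smul_vecMulVec_of_add_eq {A B : Matrix ι ι ℝ} (hA : A.PosSemidef)
    (hB : B.PosSemidef) {a b : ℝ} (ha : 0 < a) (hb : 0 ≤ b) {u : ι → ℝ}
    (h : a • A + b • B = vecMulVec u u) :
    (u ⬝ᵥ u) • A = A.trace • vecMulVec u u := by
  refine hA.smul_eq_trace_smul_vecMulVec u fun v hv => ?_
  have hAv : 0 ≤ v ⬝ᵥ (A *ᵥ v) := by simpa using hA.dotProduct_mulVec_nonneg v
  have hBv : 0 ≤ v ⬝ᵥ (B *ᵥ v) := by simpa using hB.dotProduct_mulVec_nonneg v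
  have hsum : a * (v ⬝ᵥ (A *ᵥ v)) + b * (v ⬝ᵥ (B *ᵥ v)) = 0 := by
    have := congrArg (fun M => v ⬝ᵥ (M *ᵥ v)) h
    simpa [add_mulVec, smul_mulVec, dotProduct_add, vecMulVec_mulVec, hv] using this
  nlinarith [mul_nonneg hb hBv, mul_nonneg ha.le hAv]

end Matrix.PosSemidef

/-- **Rank-one members of a sparsity spectrahedron are extreme points.**
For any simple graph `G` on `{1, …, n}` and `α > 0`: if `u ∈ ℝ^n` satisfies `‖u‖² = α` and
`uuᵀ ∈ S_G`, then `uuᵀ` is an extreme point of `S_G`; moreover `0` is an extreme point of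
`S_G`. -/
theorem rank_one_extreme_in_graphSpectrahedron {n : ℕ}
    (G : SimpleGraph (Fin n)) (α : ℝ) (hα : 0 < α) :
    (∀ u : Fin n → ℝ, (∑ i, u i ^ 2) = α →
        Matrix.vecMulVec u u ∈ graphSpectrahedron n G α →
        Matrix.vecMulVec u u ∈ Set.extremePoints ℝ (graphSpectrahedron n G α)) ∧
      (0 : Matrix (Fin n) (Fin n) ℝ) ∈ Set.extremePoints ℝ (graphSpectrahedron n G α) := by
  constructor
  · intro u hu hmem
    refine ⟨hmem, ?_⟩
    rintro A ⟨hA, hAα, -⟩ B ⟨hB, hBα, -⟩ ⟨a, b, ha, hb, hab, h⟩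
    have huu : u ⬝ᵥ u = α := by simpa [dotProduct, sq] using hu
    have htr : a * A.trace + b * B.trace = α := by
      simpa [Matrix.trace_vecMulVec, huu] using congrArg Matrix.trace h
    have hAtr : A.trace = α := by
      refine le_antisymm hAα ?_
      have h₁ : b * B.trace ≤ b * α := mul_le_mul_of_nonneg_left hBα hb.le
      have h₂ : a * α ≤ a * A.trace := by
        have h₃ : a * α + b * α = α := by rw [← add_mul, hab, one_mul]
        linarith
      exact le_of_mul_le_mul_left h₂ ha
    have hsmul := hA.smul_eq_trace_smul_vecMulVec_of_add_eq hB ha hb.le h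
    rw [huu, hAtr] at hsmul
    exact smul_right_injective _ hα.ne' hsmul
  · refine ⟨⟨.zero, by simpa using hα.le, fun _ _ _ _ => rfl⟩, ?_⟩
    rintro A ⟨hA, -, -⟩ B ⟨hB, -, -⟩ ⟨a, b, ha, hb, -, h⟩
    have htr : a * A.trace + b * B.trace = 0 := by simpa using congrArg Matrix.trace h
    refine hA.trace_eq_zero_iff.mp ?_
    nlinarith [mul_nonneg hb.le hB.trace_nonneg, mul_nonneg ha.le hA.trace_nonneg,
      hA.trace_nonneg]
end
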